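/- Let G be a 1-planar graph and u, v ∈ V(G) two vertices between which G contains a fence F(u,v) as a subgraph. Then in every 1-planar drawing of G the two single edges of F(u,v) cross each other (and consequently u and v lie on a common face of the drawing). -/

import Mathlib

open scoped unitInterval

namespace OnePlanarity

/-- The six crossing types of a crossing in a 1-planar drawing. -/
inductive CrossingType : Type
  | full | almostFull | bowtie | arrow | chair | timesCross
  deriving DecidableEq

/-- The three crossing types in which the four endpoints of the crossing edges
lie on a common 4-cycle using the two crossing edges. -/
def goodTypes : Set CrossingType :=
  {CrossingType.full, CrossingType.almostFull, CrossingType.bowtie}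

/-- The three "bad" crossing types. -/
def badTypes : Set CrossingType :=
  {CrossingType.arrow, CrossingType.chair, CrossingType.timesCross}

variable {V : Type*} {W : Type*}

/-- `HasCrossingType G a b c d t` says that, assuming the edges `ab` and `cd` of `G`
cross, the subgraph of `G` induced by `{a,b,c,d}` witnesses the crossing type `t`. -/
def HasCrossingType (G : SimpleGraph V) (a b c d : V) : CrossingType → Prop
  | .full => G.Adj a c ∧ G.Adj a d ∧ G.Adj b c ∧ G.Adj b d
  | .almostFull =>
      (¬G.Adj a c ∧ G.Adj a d ∧ G.Adj b c ∧ G.Adj b d) ∨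
      (G.Adj a c ∧ ¬G.Adj a d ∧ G.Adj b c ∧ G.Adj b d) ∨
      (G.Adj a c ∧ G.Adj a d ∧ ¬G.Adj b c ∧ G.Adj b d) ∨
      (G.Adj a c ∧ G.Adj a d ∧ G.Adj b c ∧ ¬G.Adj b d)
  | .bowtie =>
      (G.Adj a c ∧ G.Adj b d ∧ ¬G.Adj a d ∧ ¬G.Adj b c) ∨
      (G.Adj a d ∧ G.Adj b c ∧ ¬G.Adj a c ∧ ¬G.Adj b d)
  | .arrow =>
      (G.Adj a c ∧ G.Adj a d ∧ ¬G.Adj b c ∧ ¬G.Adj b d) ∨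
      (G.Adj b c ∧ G.Adj b d ∧ ¬G.Adj a c ∧ ¬G.Adj a d) ∨
      (G.Adj a c ∧ G.Adj b c ∧ ¬G.Adj a d ∧ ¬G.Adj b d) ∨
      (G.Adj a d ∧ G.Adj b d ∧ ¬G.Adj a c ∧ ¬G.Adj b c)
  | .chair =>
      (G.Adj a c ∧ ¬G.Adj a d ∧ ¬G.Adj b c ∧ ¬G.Adj b d) ∨
      (¬G.Adj a c ∧ G.Adj a d ∧ ¬G.Adj b c ∧ ¬G.Adj b d) ∨
      (¬G.Adj a c ∧ ¬G.Adj a d ∧ G.Adj b c ∧ ¬G.Adj b d) ∨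
      (¬G.Adj a c ∧ ¬G.Adj a d ∧ ¬G.Adj b c ∧ G.Adj b d)
  | .timesCross => ¬G.Adj a c ∧ ¬G.Adj a d ∧ ¬G.Adj b c ∧ ¬G.Adj b d

/-- `IsArc A x y` says that `A` is the image of a simple curve from `x` to `y`. -/
def IsArc (A : Set (ℝ × ℝ)) (x y : ℝ × ℝ) : Prop :=
  ∃ f : I → ℝ × ℝ, Continuous f ∧ Function.Injective f ∧
    f 0 = x ∧ f 1 = y ∧ Set.range f = A

/-- A drawing of a graph `G` in the plane: vertices are mapped to distinct points,
every edge is mapped to a simple curve between the images of its endpoints avoiding the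
images of all other vertices, and two edges intersect in finitely many points. -/
structure Drawing (G : SimpleGraph V) where
  pos : V → ℝ × ℝ
  pos_inj : Function.Injective pos
  arc : Sym2 V → Set (ℝ × ℝ)
  arc_curve : ∀ e ∈ G.edgeSet, ∀ u v : V, e = s(u, v) → IsArc (arc e) (pos u) (pos v)
  arc_avoid : ∀ e ∈ G.edgeSet, ∀ w : V, pos w ∈ arc e → w ∈ e
  arc_finite_inter : ∀ e ∈ G.edgeSet, ∀ e' ∈ G.edgeSet, e ≠ e' →
    (arc e ∩ arc e').Finite

variable {G : SimpleGraph V}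

/-- `D.Crosses e e' p` : the distinct edges `e` and `e'` of `G` cross at the point `p`
(an intersection point of their curves which is not the image of a vertex). -/
def Drawing.Crosses (D : Drawing G) (e e' : Sym2 V) (p : ℝ × ℝ) : Prop :=
  e ∈ G.edgeSet ∧ e' ∈ G.edgeSet ∧ e ≠ e' ∧
    p ∈ D.arc e ∧ p ∈ D.arc e' ∧ p ∉ Set.range D.pos

/-- A drawing is 1-planar if every edge is involved in at most one crossing and
adjacent edges do not cross. -/
def Drawing.IsOnePlanar (D : Drawing G) : Prop :=
  (∀ e e₁ e₂ p q, D.Crosses e e₁ p → D.Crosses e e₂ q → e₁ = e₂ ∧ p = q) ∧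
  (∀ e e' p, D.Crosses e e' p → ∀ v : V, v ∈ e → v ∉ e')

/-- A drawing is `S`-restricted if it is 1-planar and every crossing has a type in `S`. -/
def Drawing.IsSRestricted (D : Drawing G) (S : Set CrossingType) : Prop :=
  D.IsOnePlanar ∧
  ∀ a b c d : V, ∀ p : ℝ × ℝ, D.Crosses s(a, b) s(c, d) p →
    ∃ t ∈ S, HasCrossingType G a b c d t

/-- A graph is 1-planar if it admits a 1-planar drawing. -/
def IsOnePlanarGraph (G : SimpleGraph V) : Prop :=
  ∃ D : Drawing G, D.IsOnePlanar

/-- A graph is `S`-restricted if it admits an `S`-restricted drawing. -/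
def SRestricted (G : SimpleGraph V) (S : Set CrossingType) : Prop :=
  ∃ D : Drawing G, D.IsSRestricted S

/-- A planar graph: one admitting a crossing-free drawing. -/
def IsPlanarGraph (G : SimpleGraph V) : Prop :=
  ∃ D : Drawing G, ∀ e e' p, ¬ D.Crosses e e' p

/-- A drawing is geometric if every edge is drawn as a straight-line segment. -/
def Drawing.IsGeometric (D : Drawing G) : Prop :=
  ∀ u v : V, G.Adj u v → D.arc s(u, v) = segment ℝ (D.pos u) (D.pos v)

/-- The point set of a drawing. -/
def Drawing.image (D : Drawing G) : Set (ℝ × ℝ) :=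
  Set.range D.pos ∪ ⋃ e ∈ G.edgeSet, D.arc e

/-- The set of points of the outer (unbounded) face of a point set `A`. -/
def outerRegion (A : Set (ℝ × ℝ)) : Set (ℝ × ℝ) :=
  {x | x ∉ A ∧ ¬ Bornology.IsBounded (connectedComponentIn Aᶜ x)}

/-- `Inside γ x` : the point `x` is separated from the outer face by the closed curve `γ`. -/
def Inside (γ : Set (ℝ × ℝ)) (x : ℝ × ℝ) : Prop :=
  x ∉ γ ∧ Bornology.IsBounded (connectedComponentIn γᶜ x)

/-- A vertex lies on (the boundary of) the outer face of a drawing. -/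
def Drawing.OnOuterFace (D : Drawing G) (v : V) : Prop :=
  D.pos v ∈ closure (outerRegion D.image)

/-- Two vertices are cofacial: they lie on the boundary of a common face. -/
def Drawing.Cofacial (D : Drawing G) (u v : V) : Prop :=
  ∃ p : ℝ × ℝ, p ∉ D.image ∧
    D.pos u ∈ closure (connectedComponentIn D.imageᶜ p) ∧
    D.pos v ∈ closure (connectedComponentIn D.imageᶜ p)

/-- A graph admits a geometric `S`-restricted drawing. -/
def GeoSRestricted (G : SimpleGraph V) (S : Set CrossingType) : Prop :=
  ∃ D : Drawing G, D.IsGeometric ∧ D.IsSRestricted S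

/-- `OGeoSRestricted G S O` : the graph `G` admits a geometric `S`-restricted drawing
in which the vertex of `O` (if any) lies on the outer face. -/
def OGeoSRestricted (G : SimpleGraph V) (S : Set CrossingType) (O : Set V) : Prop :=
  ∃ D : Drawing G, D.IsGeometric ∧ D.IsSRestricted S ∧ ∀ v ∈ O, D.OnOuterFace v

/-- `k`-connectivity. -/
def KConnected (k : ℕ) (G : SimpleGraph V) : Prop :=
  k < Nat.card V ∧ ∀ T : Set V, T.ncard < k → (G.induce Tᶜ).Connected

/-- A vertex has degree exactly two. -/
def DegTwo (G : SimpleGraph V) (w : V) : Prop :=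
  ∃ a b : V, a ≠ b ∧ G.neighborSet w = {a, b}

/-- The simple graph obtained from `G` by suppressing the degree-2 vertices in `W`. -/
def suppress (G : SimpleGraph V) (Ws : Set V) : SimpleGraph {v : V // v ∉ Ws} :=
  SimpleGraph.fromRel (fun a b =>
    G.Adj a.1 b.1 ∨ ∃ w ∈ Ws, G.Adj w a.1 ∧ G.Adj w b.1)

/-- A graph is internally 3-connected if it is obtained from a 3-connected (multi)graph by
subdividing a subset of its edges once each. -/
def InternallyThreeConnected (G : SimpleGraph V) : Prop :=
  ∃ Ws : Set V, (∀ w ∈ Ws, DegTwo G w) ∧ (∀ w ∈ Ws, ∀ u ∈ Ws, ¬ G.Adj w u) ∧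
    KConnected 3 (suppress G Ws)

/-- `IsSeparation G T X₁ X₂` : `(X₁, X₂)` is a separation of `G` induced by the separator `T`. -/
def IsSeparation (G : SimpleGraph V) (T X₁ X₂ : Set V) : Prop :=
  X₁ ∪ X₂ = Set.univ ∧ X₁ ∩ X₂ = T ∧ (X₁ \ T).Nonempty ∧ (X₂ \ T).Nonempty ∧
  ∀ u ∈ X₁ \ T, ∀ v ∈ X₂ \ T, ∀ p : G.Walk u v, ∃ w ∈ T, w ∈ p.support

end OnePlanarity
namespace OnePlanarity

variable {V : Type*}

/-- The endpoints of the eight bundled `K₅`-edges of a fence on branch vertices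
`u, v, w₁, w₂, w₃` (all `K₅`-edges except the two single edges `u w₂` and `v w₁`). -/
def fenceEnds (u v w₁ w₂ w₃ : V) : Fin 8 → V × V :=
  ![(u, v), (u, w₁), (u, w₃), (v, w₂), (v, w₃), (w₁, w₂), (w₁, w₃), (w₂, w₃)]

/-- A fence `F(u,v)` between `u` and `v`, contained in `G` as a subgraph: a `K₅` on
`u, v, w₁, w₂, w₃` in which every edge except the two single edges `u w₂` and `v w₁` is
replaced by a bundle of `12` internally disjoint paths of length two. -/
structure Fence (G : SimpleGraph V) (u v : V) where
  w₁ : V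
  w₂ : V
  w₃ : V
  mid : Fin 8 → Fin 12 → V
  branch_inj : Function.Injective ![u, v, w₁, w₂, w₃]
  mid_inj : Function.Injective (Function.uncurry mid)
  mid_not_branch : ∀ i j, mid i j ∉ ({u, v, w₁, w₂, w₃} : Set V)
  single₁ : G.Adj u w₂
  single₂ : G.Adj v w₁
  bundles : ∀ i j, G.Adj (fenceEnds u v w₁ w₂ w₃ i).1 (mid i j) ∧
    G.Adj (mid i j) (fenceEnds u v w₁ w₂ w₃ i).2

section

open Set Topology

theorem exists_continuous_log {A : Type*} [TopologicalSpace A] [SimplyConnectedSpace A]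
    [LocallyPathConnectedSpace A] {f : A → ℂ} (hf : Continuous f) (h0 : ∀ a, f a ≠ 0) :
    ∃ L : A → ℂ, Continuous L ∧ ∀ a, Complex.exp (L a) = f a := by
  have a₀ : A := Classical.choice inferInstance
  obtain ⟨F, ⟨-, hF⟩, -⟩ := Complex.isCoveringMapOn_exp.existsUnique_continuousMap_lifts
    ⟨f, hf⟩ (a₀ := a₀) (e₀ := Complex.log (f a₀)) (Complex.exp_log (h0 a₀)) (fun a => h0 a)
  exact ⟨F, F.continuous, fun a => congrFun hF a⟩

theorem eq_of_exp_eq_const {X : Type*} [TopologicalSpace X] {S : Set X} (hS : IsPreconnected S)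
    {k : X → ℂ} (hk : ContinuousOn k S) {c : ℂ} (hc : ∀ x ∈ S, Complex.exp (k x) = c)
    {x y : X} (hx : x ∈ S) (hy : y ∈ S) : k x = k y := by
  refine hS.induction₂ (fun x y => k x = k y) ?_ (fun _ _ _ _ _ _ h h' => h.trans h')
    (fun _ _ _ _ h => h.symm) hx hy
  intro a ha
  have h1 : ∀ᶠ b in 𝓝[S] a, dist (k b) (k a) < 1 :=
    (hk a ha).eventually (Metric.ball_mem_nhds _ one_pos)
  filter_upwards [h1, self_mem_nhdsWithin] with b hb hbS
  obtain ⟨n, hn⟩ := Complex.exp_eq_exp_iff_exists_int.1 ((hc b hbS).trans (hc a ha).symm)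
  rw [hn, dist_eq_norm, add_sub_cancel_left, norm_mul, Complex.norm_intCast] at hb
  have h2 : ‖(2 * Real.pi * Complex.I : ℂ)‖ = 2 * Real.pi := by
    simp [abs_of_pos Real.pi_pos]
  rw [h2] at hb
  have h3 : |(n : ℝ)| < 1 := by nlinarith [Real.pi_gt_three, abs_nonneg (n : ℝ)]
  have h4 : n = 0 := by
    have : |n| < 1 := by exact_mod_cast h3
    exact Int.abs_lt_one_iff.1 this
  rw [hn, h4]; simp

/-- Two continuous logarithms of proportional functions differ by a constant. -/
theorem log_sub_eq {X : Type*} [TopologicalSpace X] {S : Set X} (hS : IsPreconnected S)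
    {k l : X → ℂ} (hk : ContinuousOn k S) (hl : ContinuousOn l S) {c : ℂ}
    (hc : ∀ x ∈ S, Complex.exp (k x) = c * Complex.exp (l x))
    {x y : X} (hx : x ∈ S) (hy : y ∈ S) : k x - k y = l x - l y := by
  have := eq_of_exp_eq_const hS (hk.sub hl) (c := c) (fun z hz => by
    simp only [Pi.sub_apply]
    rw [Complex.exp_sub, hc z hz, mul_div_cancel_right₀ _ (Complex.exp_ne_zero _)]) hx hy
  simp only [Pi.sub_apply] at this
  linear_combination this

theorem false_of_crossing_number_parity (n : Fin 5 → Fin 5 → Fin 5 → ℤ)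
    (h : ∀ a b c d : Fin 5, a < b → c < d → a < c → b ≠ c → b ≠ d →
      n c a b + n b c d - n d a b - n a c d = if c < b ∧ b < d then 1 else 0) : False := by
  have h1 := h 0 1 2 3 (by decide) (by decide) (by decide) (by decide) (by decide)
  have h2 := h 0 1 2 4 (by decide) (by decide) (by decide) (by decide) (by decide)
  have h3 := h 0 1 3 4 (by decide) (by decide) (by decide) (by decide) (by decide)
  have h4 := h 0 2 1 3 (by decide) (by decide) (by decide) (by decide) (by decide)
  have h5 := h 0 2 1 4 (by decide) (by decide) (by decide) (by decide) (by decide)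
  have h6 := h 0 2 3 4 (by decide) (by decide) (by decide) (by decide) (by decide)
  have h7 := h 0 3 1 2 (by decide) (by decide) (by decide) (by decide) (by decide)
  have h8 := h 0 3 1 4 (by decide) (by decide) (by decide) (by decide) (by decide)
  have h9 := h 0 3 2 4 (by decide) (by decide) (by decide) (by decide) (by decide)
  have h10 := h 0 4 1 2 (by decide) (by decide) (by decide) (by decide) (by decide)
  have h11 := h 0 4 1 3 (by decide) (by decide) (by decide) (by decide) (by decide)
  have h12 := h 0 4 2 3 (by decide) (by decide) (by decide) (by decide) (by decide)
  have h13 := h 1 2 3 4 (by decide) (by decide) (by decide) (by decide) (by decide)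
  have h14 := h 1 3 2 4 (by decide) (by decide) (by decide) (by decide) (by decide)
  have h15 := h 1 4 2 3 (by decide) (by decide) (by decide) (by decide) (by decide)
  simp +decide only [if_true, if_false] at *
  omega

theorem K5_not_planar_complex (z : Fin 5 → ℂ) (E : Fin 5 → Fin 5 → Set ℂ)
    (hE : ∀ i j, i < j → JoinedIn (E i j) (z i) (z j))
    (hdisj : ∀ i j k l, i < j → k < l → i ≠ k → i ≠ l → j ≠ k → j ≠ l →
      Disjoint (E i j) (E k l)) : False := by
  have hg : ∀ i j, ∃ g : ℝ → ℂ, i < j →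
      Continuous g ∧ g 0 = z i ∧ g 1 = z j ∧ ∀ t, g t ∈ E i j := by
    intro i j
    by_cases hij : i < j
    · obtain ⟨γ, hγ⟩ := hE i j hij
      exact ⟨γ.extend, fun _ => ⟨γ.continuous_extend, γ.extend_zero, γ.extend_one,
        fun t => hγ _⟩⟩
    · exact ⟨0, fun h => absurd h hij⟩
  choose g hg using hg
  have hzE : ∀ c a b : Fin 5, a < b → c ≠ a → c ≠ b → z c ∉ E a b := by
    intro c a b hab hca hcb hmem
    have : ∃ k : Fin 5, k ≠ a ∧ k ≠ b ∧ k ≠ c := by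
      clear * -; decide +revert
    obtain ⟨k, hka, hkb, hkc⟩ := this
    rcases lt_or_gt_of_ne hkc with h | h
    · exact (hdisj k c a b h hab hka hkb hca hcb).le_bot ⟨(hE k c h).mem.2, hmem⟩
    · exact (hdisj c k a b h hab hca hcb hka hkb).le_bot ⟨(hE c k h).mem.1, hmem⟩
  have hzne : ∀ i j, i ≠ j → z i ≠ z j := by
    intro i j hij h
    have : ∃ a : Fin 5, a ≠ i ∧ a ≠ j := by
      clear * -; decide +revert
    obtain ⟨a, hai, haj⟩ := this
    rcases lt_or_gt_of_ne haj with h' | h'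
    · exact hzE i a j h' hai.symm hij (h ▸ (hE a j h').mem.2)
    · exact hzE i j a h' hij hai.symm (h ▸ (hE j a h').mem.1)
  let α : Fin 5 → Fin 5 → ℂ := fun i j =>
    if i < j then Complex.log (z j - z i) else Complex.log (z i - z j) + Real.pi * Complex.I
  have hα : ∀ i j, i ≠ j → Complex.exp (α i j) = z j - z i := by
    intro i j hij
    simp only [α]
    split_ifs
    · exact Complex.exp_log (sub_ne_zero.2 (hzne j i hij.symm))
    · rw [Complex.exp_add, Complex.exp_log (sub_ne_zero.2 (hzne i j hij)), Complex.exp_pi_mul_I]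
      ring
  have hα' : ∀ i j, i < j → α j i = α i j + Real.pi * Complex.I := by
    intro i j hij
    simp only [α, if_pos hij, if_neg hij.not_gt]
  have hn : ∀ c a b, ∃ n : ℤ, a < b → c ≠ a → c ≠ b → ∀ L : ℝ → ℂ, Continuous L →
      (∃ k, ∀ t, Complex.exp (L t) = k * (g a b t - z c)) →
      L 1 - L 0 = α c b - α c a + n * (2 * Real.pi * Complex.I) := by
    intro c a b
    by_cases hab : a < b ∧ c ≠ a ∧ c ≠ b
    · obtain ⟨hab, hca, hcb⟩ := hab
      obtain ⟨hgc, hg0, hg1, hgE⟩ := hg a b hab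
      obtain ⟨M, hM, hMe⟩ := exists_continuous_log (f := fun t => g a b t - z c)
        (by fun_prop) (fun t h => hzE c a b hab hca hcb (sub_eq_zero.1 h ▸ hgE t))
      have e0 : Complex.exp (M 0) = Complex.exp (α c a) := by rw [hMe, hα _ _ hca, hg0]
      have e1 : Complex.exp (M 1) = Complex.exp (α c b) := by rw [hMe, hα _ _ hcb, hg1]
      obtain ⟨n0, h0⟩ := Complex.exp_eq_exp_iff_exists_int.1 e0
      obtain ⟨n1, h1⟩ := Complex.exp_eq_exp_iff_exists_int.1 e1
      refine ⟨n1 - n0, fun _ _ _ L hL ⟨k, hk⟩ => ?_⟩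
      rw [log_sub_eq isPreconnected_univ hL.continuousOn hM.continuousOn (c := k)
        (fun t _ => by rw [hk, hMe]) (mem_univ 1) (mem_univ 0), h0, h1]
      push_cast; ring
    · exact ⟨0, fun h1 h2 h3 => absurd ⟨h1, h2, h3⟩ hab⟩
  choose n hn using hn
  refine false_of_crossing_number_parity n fun a b c d hab hcd hac hbc hbd => ?_
  have had : a ≠ d := (hac.trans hcd).ne
  obtain ⟨hgc, hg0, hg1, hgE⟩ := hg a b hab
  obtain ⟨hgc', hg0', hg1', hgE'⟩ := hg c d hcd
  obtain ⟨L, hL, hLe⟩ := exists_continuous_log (A := ℝ × ℝ)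
    (f := fun p => g a b p.1 - g c d p.2) (by fun_prop) (fun p h =>
      (hdisj a b c d hab hcd hac.ne had hbc hbd).le_bot
        ⟨hgE p.1, (sub_eq_zero.1 h) ▸ hgE' p.2⟩)
  have t1 := hn c a b hab hac.ne' hbc.symm (fun t => L (t, 0)) (by fun_prop)
    ⟨1, fun t => by rw [hLe, hg0', one_mul]⟩
  have t2 := hn d a b hab had.symm hbd.symm (fun t => L (t, 1)) (by fun_prop)
    ⟨1, fun t => by rw [hLe, hg1', one_mul]⟩
  have t3 := hn a c d hcd hac.ne had (fun t => L (0, t)) (by fun_prop)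
    ⟨-1, fun t => by rw [hLe, hg0]; ring⟩
  have t4 := hn b c d hcd hbc hbd (fun t => L (1, t)) (by fun_prop)
    ⟨-1, fun t => by rw [hLe, hg1]; ring⟩
  have hpi : (Real.pi * Complex.I : ℂ) ≠ 0 := by simp [Real.pi_ne_zero]
  have key : α c b - α b c - (α c a - α a c) - (α d b - α b d) + (α d a - α a d) =
      -(if c < b ∧ b < d then 1 else 0 : ℤ) * (2 * Real.pi * Complex.I) := by
    rw [hα' a c hac, hα' a d (hac.trans hcd)]
    rcases lt_or_gt_of_ne hbc with h | h
    · have h' := h.trans hcd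
      rw [hα' b c h, hα' b d h', if_neg (fun h'' => h.not_gt h''.1)]
      push_cast; ring
    · rw [hα' c b h]
      rcases lt_or_gt_of_ne hbd with h' | h'
      · rw [hα' b d h', if_pos ⟨h, h'⟩]; push_cast; ring
      · rw [hα' d b h', if_neg (fun h'' => h'.not_gt h''.2)]; push_cast; ring
  have : ((n c a b + n b c d - n d a b - n a c d : ℤ) : ℂ) * (2 * Real.pi * Complex.I)
      = ((if c < b ∧ b < d then 1 else 0 : ℤ) : ℂ) * (2 * Real.pi * Complex.I) := by
    push_cast at key ⊢
    linear_combination -t1 + t2 + t3 - t4 - key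
  exact_mod_cast mul_right_cancel₀ (by rw [mul_assoc]; exact mul_ne_zero two_ne_zero hpi) this

theorem exists_mem_closure_diff {X : Type*} [TopologicalSpace X] {S F : Set X}
    (hS : IsPreconnected S) (hF : IsOpen F) {a b : X} (ha : a ∈ S) (haF : a ∈ F)
    (hb : b ∈ S) (hbF : b ∉ F) : ∃ z ∈ S, z ∈ closure F ∧ z ∉ F := by
  by_contra! h
  have hb' : b ∉ closure F := fun h' => hbF (h b hb h')
  obtain ⟨z, -, hz, hz'⟩ := hS F (closure F)ᶜ hF isClosed_closure.isOpen_compl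
    (fun z hz => (em (z ∈ closure F)).imp (h z hz) id) ⟨a, ha, haF⟩ ⟨b, hb, hb'⟩
  exact hz' (subset_closure hz)

theorem closure_connectedComponentIn_inter_subset {X : Type*} [TopologicalSpace X] {U : Set X}
    {x : X} : closure (connectedComponentIn U x) ∩ U ⊆ connectedComponentIn U x := by
  rintro z ⟨hz, hzU⟩
  by_cases hx : x ∈ U
  · have h1 : IsPreconnected (insert z (connectedComponentIn U x)) :=
      isPreconnected_connectedComponentIn.subset_closure (subset_insert _ _)
        (insert_subset hz subset_closure)
    exact h1.subset_connectedComponentIn (mem_insert_of_mem _ (mem_connectedComponentIn hx))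
      (insert_subset hzU (connectedComponentIn_subset _ _)) (mem_insert _ _)
  · simp [connectedComponentIn_eq_empty hx] at hz

/-- `HasLogOn g K` says that `g` has a continuous logarithm on `K`. -/
def HasLogOn (g : ℂ → ℂ) (K : Set ℂ) : Prop :=
  ∃ h : ℂ → ℂ, ContinuousOn h K ∧ ∀ z ∈ K, Complex.exp (h z) = g z

theorem HasLogOn.congr {f g : ℂ → ℂ} {K : Set ℂ} (hf : HasLogOn f K) (h : ∀ z ∈ K, f z = g z) :
    HasLogOn g K := by
  obtain ⟨k, hk, hk'⟩ := hf
  exact ⟨k, hk, fun z hz => (hk' z hz).trans (h z hz)⟩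

theorem HasLogOn.mul {f g : ℂ → ℂ} {K : Set ℂ} (hf : HasLogOn f K) (hg : HasLogOn g K) :
    HasLogOn (fun z => f z * g z) K := by
  obtain ⟨k, hk, hk'⟩ := hf
  obtain ⟨l, hl, hl'⟩ := hg
  exact ⟨fun z => k z + l z, hk.add hl, fun z hz => by
    rw [Complex.exp_add, hk' z hz, hl' z hz]⟩

theorem HasLogOn.inv {f : ℂ → ℂ} {K : Set ℂ} (hf : HasLogOn f K) :
    HasLogOn (fun z => (f z)⁻¹) K := by
  obtain ⟨k, hk, hk'⟩ := hf
  exact ⟨fun z => -k z, hk.neg, fun z hz => by rw [Complex.exp_neg, hk' z hz]⟩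

theorem hasLogOn_of_isPreconnected {K S : Set ℂ} (hK : IsClosed K) (hS : IsPreconnected S)
    (hSK : Disjoint S K) {a b : ℂ} (ha : a ∈ S) (hb : b ∈ S) :
    HasLogOn (fun z => (z - a) / (z - b)) K := by
  have hne : ∀ c ∈ S, ∀ z ∈ K, z - c ≠ 0 := fun c hc z hz h =>
    hSK.le_bot ⟨hc, sub_eq_zero.1 h ▸ hz⟩
  refine hS.induction₂ (fun a b => HasLogOn (fun z => (z - a) / (z - b)) K) ?_ ?_ ?_ ha hb
  · intro c hc
    obtain ⟨r, hr, hball⟩ := Metric.isOpen_iff.1 hK.isOpen_compl c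
      (fun h => hSK.le_bot ⟨hc, h⟩)
    refine nhdsWithin_le_nhds ?_
    filter_upwards [Metric.ball_mem_nhds c hr] with d hd
    have hd' : ∀ z ∈ K, (z - d) / (z - c) ∈ Complex.slitPlane := by
      intro z hz
      have hzc : r ≤ ‖z - c‖ := by
        by_contra! h
        exact hball (mem_ball_iff_norm.2 h) hz
      have : ‖(z - d) / (z - c) - 1‖ < 1 := by
        rw [div_sub_one (hne c hc z hz), norm_div, div_lt_one (hr.trans_le hzc)]
        refine lt_of_lt_of_le ?_ hzc
        rw [mem_ball_iff_norm, norm_sub_rev] at hd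
        simpa using hd
      have h2 := Complex.mem_slitPlane_of_norm_lt_one this
      simpa using h2
    have : HasLogOn (fun z => (z - d) / (z - c)) K := by
      refine ⟨fun z => Complex.log ((z - d) / (z - c)), ContinuousOn.clog ?_ hd', fun z hz => ?_⟩
      · exact ContinuousOn.div (by fun_prop) (by fun_prop) (hne c hc)
      · exact Complex.exp_log (Complex.slitPlane_ne_zero (hd' z hz))
    exact this.inv.congr fun z _ => inv_div _ _
  · intro x y z _ hy _ h1 h2
    exact (h1.mul h2).congr fun w hw => div_mul_div_cancel₀ (hne y hy w hw)
  · intro x y _ _ h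
    exact h.inv.congr fun z _ => inv_div _ _

theorem not_log_sub_on_plane {L : ℂ → ℂ} (hL : Continuous L) {a : ℂ} {R : ℝ} (hR : 0 < R)
    (h : ∀ z, ‖z - a‖ = R → Complex.exp (L z) = z - a) : False := by
  have hexp : ∀ t : ℝ, Complex.exp (L (a + R * Complex.exp (t * Complex.I))) =
      R * Complex.exp (t * Complex.I) := by
    intro t
    rw [h, add_sub_cancel_left]
    rw [add_sub_cancel_left, norm_mul, Complex.norm_exp_ofReal_mul_I]
    simp [abs_of_pos hR]
  have := log_sub_eq (S := (univ : Set ℝ)) isPreconnected_univ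
    (k := fun t : ℝ => L (a + R * Complex.exp (t * Complex.I)))
    (l := fun t : ℝ => t * Complex.I) (c := R) (by fun_prop) (by fun_prop)
    (fun t _ => hexp t) (mem_univ (2 * Real.pi)) (mem_univ 0)
  simp [Real.pi_ne_zero] at this

theorem mem_component_of_hasLogOn_of_isBounded {K : Set ℂ} (hK : IsClosed K) {a b : ℂ}
    (ha : a ∉ K) (hb : b ∉ K) (hlog : HasLogOn (fun z => (z - a) / (z - b)) K)
    (hbdd : Bornology.IsBounded (connectedComponentIn Kᶜ a)) :
    b ∈ connectedComponentIn Kᶜ a := by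
  classical
  by_contra hbU
  set U := connectedComponentIn Kᶜ a with hU
  have hUo : IsOpen U := hK.isOpen_compl.connectedComponentIn
  have haU : a ∈ U := mem_connectedComponentIn ha
  obtain ⟨h, hh, hexp⟩ := hlog
  obtain ⟨H, hH⟩ := ContinuousMap.exists_restrict_eq hK ⟨K.domRestrict h, hh.domRestrict⟩
  have hHK : ∀ z ∈ K, H z = h z := fun z hz => by
    have := DFunLike.congr_fun hH ⟨z, hz⟩
    exact this
  let f : ℂ → ℂ := fun z => if z ∈ U then (z - b) * Complex.exp (H z) else z - a
  have hf : Continuous f := by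
    refine Continuous.if ?_ (by fun_prop) (by fun_prop)
    intro z hz
    have hzK : z ∈ K := by
      by_contra hzK
      have hz2 : z ∈ closure U \ interior U := hz
      rw [hUo.interior_eq] at hz2
      exact hz2.2 (closure_connectedComponentIn_inter_subset ⟨hz2.1, hzK⟩)
    have hzb : z - b ≠ 0 := fun h => hb (sub_eq_zero.1 h ▸ hzK)
    rw [hHK z hzK, hexp z hzK, mul_div_cancel₀ _ hzb]
  have hf0 : ∀ z, f z ≠ 0 := by
    intro z
    simp only [f]
    split_ifs with hz
    · exact mul_ne_zero (fun h => hbU (sub_eq_zero.1 h ▸ hz)) (Complex.exp_ne_zero _)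
    · exact fun h => hz (sub_eq_zero.1 h ▸ haU)
  obtain ⟨L, hL, hLe⟩ := exists_continuous_log hf hf0
  obtain ⟨R, hR, hUR⟩ := hbdd.subset_ball_lt 0 a
  refine not_log_sub_on_plane hL hR (a := a) fun z hz => ?_
  rw [hLe]
  refine if_neg fun hzU => ?_
  have := hUR hzU
  rw [mem_ball_iff_norm] at this
  exact this.ne hz

theorem isPreconnected_norm_gt (R : ℝ) : IsPreconnected {z : ℂ | R < ‖z‖} := by
  have : {z : ℂ | R < ‖z‖} =
      (fun p : ℝ × ℝ => (p.1 : ℂ) * Complex.exp (p.2 * Complex.I)) '' (Ioi R ×ˢ univ) := by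
    ext z
    constructor
    · intro hz
      exact ⟨(‖z‖, Complex.arg z), ⟨hz, mem_univ _⟩, Complex.norm_mul_exp_arg_mul_I z⟩
    · rintro ⟨⟨r, t⟩, ⟨hr, -⟩, rfl⟩
      simp only [mem_Ioi] at hr
      simp only [mem_ofPred_eq, norm_mul, Complex.norm_exp_ofReal_mul_I, Complex.norm_real]
      simpa using hr.trans_le (le_abs_self r)
  rw [this]
  exact (isPreconnected_Ioi.prod isPreconnected_univ).image _ (by fun_prop)

/-- Eilenberg's criterion: a continuous logarithm of `(z - a) / (z - b)` on a compact set `K`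
prevents `K` from separating `a` and `b`. -/
theorem mem_component_of_hasLogOn {K : Set ℂ} (hK : IsCompact K) {a b : ℂ}
    (ha : a ∉ K) (hb : b ∉ K) (hlog : HasLogOn (fun z => (z - a) / (z - b)) K) :
    b ∈ connectedComponentIn Kᶜ a := by
  by_cases h1 : Bornology.IsBounded (connectedComponentIn Kᶜ a)
  · exact mem_component_of_hasLogOn_of_isBounded hK.isClosed ha hb hlog h1
  by_cases h2 : Bornology.IsBounded (connectedComponentIn Kᶜ b)
  · rw [← connectedComponentIn_eq (mem_component_of_hasLogOn_of_isBounded hK.isClosed hb ha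
      (hlog.inv.congr fun z _ => inv_div _ _) h2)]
    exact mem_connectedComponentIn hb
  obtain ⟨R, hR, hKR⟩ := hK.isBounded.subset_closedBall_lt 0 0
  have hout : {z : ℂ | R < ‖z‖} ⊆ Kᶜ := fun z hz hzK => by
    have := hKR hzK
    rw [mem_closedBall_zero_iff] at this
    exact this.not_gt hz
  have hmeet : ∀ c, ¬ Bornology.IsBounded (connectedComponentIn Kᶜ c) →
      ∃ z ∈ connectedComponentIn Kᶜ c, R < ‖z‖ := by
    intro c hc
    by_contra! h
    exact hc (Metric.isBounded_closedBall.subset fun z hz => mem_closedBall_zero_iff.2 (h z hz))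
  obtain ⟨x, hx, hxR⟩ := hmeet a h1
  obtain ⟨y, hy, hyR⟩ := hmeet b h2
  have := (isPreconnected_norm_gt R).subset_connectedComponentIn hxR hout hyR
  rw [connectedComponentIn_eq hx, connectedComponentIn_eq this, ← connectedComponentIn_eq hy]
  exact mem_connectedComponentIn hb

theorem hasLogOn_arc {f : ℝ → ℂ} {c d : ℝ} (hcd : c ≤ d) (hf : ContinuousOn f (Icc c d))
    (hinj : InjOn f (Icc c d)) {g : ℂ → ℂ} (hg : ContinuousOn g (f '' Icc c d))
    (hg0 : ∀ z ∈ f '' Icc c d, g z ≠ 0) : HasLogOn g (f '' Icc c d) := by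
  classical
  have hgf : ContinuousOn (g ∘ f) (Icc c d) := hg.comp hf (mapsTo_image _ _)
  obtain ⟨ℓ, hℓ, hℓe⟩ := exists_continuous_log (f := IccExtend hcd ((Icc c d).domRestrict (g ∘ f)))
    (hgf.domRestrict.Icc_extend') (fun t => hg0 _ (mem_image_of_mem _ (projIcc c d hcd t).2))
  let q : Icc c d → f '' Icc c d := fun t => ⟨f t, mem_image_of_mem _ t.2⟩
  have hq : Continuous q := hf.domRestrict.subtype_mk _
  have hqs : Function.Surjective q := by
    rintro ⟨_, t, ht, rfl⟩
    exact ⟨⟨t, ht⟩, rfl⟩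
  have hqq : IsQuotientMap q := hq.isClosedMap.isQuotientMap hq hqs
  have hinv : ∀ t ∈ Icc c d, Function.invFunOn f (Icc c d) (f t) = t := fun t ht =>
    hinj.leftInvOn_invFunOn ht
  refine ⟨fun z => ℓ (Function.invFunOn f (Icc c d) z), ?_, ?_⟩
  · rw [continuousOn_iff_continuous_domRestrict, hqq.continuous_iff]
    refine (hℓ.comp continuous_subtype_val).congr fun t => ?_
    simp only [Function.comp_apply, domRestrict_apply, q]
    rw [hinv t t.2]
  · rintro _ ⟨t, ht, rfl⟩
    simp only
    rw [hinv t ht, hℓe, IccExtend_of_mem _ _ ht]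
    rfl

theorem HasLogOn.union {g : ℂ → ℂ} {K T : Set ℂ} (hK : IsClosed K) (hT : IsClosed T)
    (hgK : HasLogOn g K) (hgT : HasLogOn g T) {x : ℂ} (hKT : K ∩ T ⊆ {x}) :
    HasLogOn g (K ∪ T) := by
  classical
  obtain ⟨k, hk, hke⟩ := hgK
  obtain ⟨l, hl, hle⟩ := hgT
  by_cases hx : x ∈ K ∧ x ∈ T
  · let m : ℂ → ℂ := fun z => l z + (k x - l x)
    have hm : ∀ z ∈ T, Complex.exp (m z) = g z := by
      intro z hz
      simp only [m]
      rw [Complex.exp_add, hle z hz, Complex.exp_sub, hke x hx.1, hle x hx.2, div_self, mul_one]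
      rw [← hle x hx.2]; exact Complex.exp_ne_zero _
    refine ⟨fun z => if z ∈ K then k z else m z, ?_, ?_⟩
    · refine ContinuousOn.union_of_isClosed ?_ ?_ hK hT
      · exact hk.congr fun z hz => if_pos hz
      · refine (hl.add continuousOn_const : ContinuousOn m T).congr fun z hz => ?_
        split_ifs with hzK
        · rw [hKT ⟨hzK, hz⟩]; simp
        · rfl
    · rintro z hz
      simp only
      split_ifs with hzK
      · exact hke z hzK
      · exact hm z (hz.resolve_left hzK)
  · have hdis : ∀ z ∈ T, z ∉ K := fun z hz hzK => by
      have := hKT ⟨hzK, hz⟩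
      rw [mem_singleton_iff] at this
      exact hx ⟨this ▸ hzK, this ▸ hz⟩
    refine ⟨fun z => if z ∈ K then k z else l z, ?_, ?_⟩
    · refine ContinuousOn.union_of_isClosed ?_ ?_ hK hT
      · exact hk.congr fun z hz => if_pos hz
      · exact hl.congr fun z hz => if_neg (hdis z hz)
    · rintro z hz
      simp only
      split_ifs with hzK
      · exact hke z hzK
      · exact hle z (hz.resolve_left hzK)

/-- Attaching an arc to a compact set at one of its points separates no further points. -/
theorem exists_isPreconnected_avoiding_arc_complex {K : Set ℂ} (hK : IsCompact K) {f : ℝ → ℂ}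
    {c d : ℝ} (hcd : c ≤ d) (hf : ContinuousOn f (Icc c d)) (hinj : InjOn f (Icc c d)) {x : ℂ}
    (hKf : K ∩ f '' Icc c d ⊆ {x}) {S : Set ℂ} (hS : IsPreconnected S) (hSK : Disjoint S K)
    {a b : ℂ} (ha : a ∈ S) (hb : b ∈ S) (haf : a ∉ f '' Icc c d) (hbf : b ∉ f '' Icc c d) :
    ∃ S', IsPreconnected S' ∧ Disjoint S' (K ∪ f '' Icc c d) ∧ a ∈ S' ∧ b ∈ S' := by
  have hT : IsCompact (f '' Icc c d) := isCompact_Icc.image_of_continuousOn hf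
  have hne : ∀ e : ℂ, e ∉ f '' Icc c d → ∀ z ∈ f '' Icc c d, z - e ≠ 0 := fun _ he z hz h =>
    he (sub_eq_zero.1 h ▸ hz)
  have h1 := hasLogOn_of_isPreconnected hK.isClosed hS hSK ha hb
  have h2 : HasLogOn (fun z => (z - a) / (z - b)) (f '' Icc c d) :=
    hasLogOn_arc hcd hf hinj (ContinuousOn.div (by fun_prop) (by fun_prop) (hne b hbf))
      fun z hz => div_ne_zero (hne a haf z hz) (hne b hbf z hz)
  have haK : a ∉ K ∪ f '' Icc c d := fun h => h.elim (fun h => hSK.le_bot ⟨ha, h⟩) haf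
  have hbK : b ∉ K ∪ f '' Icc c d := fun h => h.elim (fun h => hSK.le_bot ⟨hb, h⟩) hbf
  refine ⟨_, isPreconnected_connectedComponentIn,
    disjoint_left.2 fun z hz => connectedComponentIn_subset _ _ hz,
    mem_connectedComponentIn haK, mem_component_of_hasLogOn (hK.union hT) haK hbK
      (h1.union hK.isClosed hT.isClosed h2 hKf)⟩

/-- The complete graph on five vertices cannot be drawn with disjoint curves for disjoint edges. -/
theorem K5_not_planar (z : Fin 5 → ℝ × ℝ) (E : Fin 5 → Fin 5 → Set (ℝ × ℝ))
    (hE : ∀ i j, i < j → JoinedIn (E i j) (z i) (z j))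
    (hdisj : ∀ i j k l, i < j → k < l → i ≠ k → i ≠ l → j ≠ k → j ≠ l →
      Disjoint (E i j) (E k l)) : False := by
  let e : ℝ × ℝ ≃ₜ ℂ := Complex.equivRealProdCLM.symm.toHomeomorph
  exact K5_not_planar_complex (fun i => e (z i)) (fun i j => e '' E i j)
    (fun i j hij => (hE i j hij).map e.continuous)
    (fun i j k l hij hkl h1 h2 h3 h4 => (disjoint_image_iff e.injective).2
      (hdisj i j k l hij hkl h1 h2 h3 h4))

theorem exists_isPreconnected_avoiding_arc {K : Set (ℝ × ℝ)} (hK : IsCompact K)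
    {f : ℝ → ℝ × ℝ} {c d : ℝ} (hcd : c ≤ d) (hf : ContinuousOn f (Icc c d))
    (hinj : InjOn f (Icc c d)) {x : ℝ × ℝ} (hKf : K ∩ f '' Icc c d ⊆ {x}) {S : Set (ℝ × ℝ)}
    (hS : IsPreconnected S) (hSK : Disjoint S K) {a b : ℝ × ℝ} (ha : a ∈ S) (hb : b ∈ S)
    (haf : a ∉ f '' Icc c d) (hbf : b ∉ f '' Icc c d) :
    ∃ S', IsPreconnected S' ∧ Disjoint S' (K ∪ f '' Icc c d) ∧ a ∈ S' ∧ b ∈ S' := by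
  let e : ℝ × ℝ ≃ₜ ℂ := Complex.equivRealProdCLM.symm.toHomeomorph
  have him : (e ∘ f) '' Icc c d = e '' (f '' Icc c d) := image_comp e f _
  obtain ⟨S', h1, h2, h3, h4⟩ := exists_isPreconnected_avoiding_arc_complex
    (hK.image e.continuous) hcd (e.continuous.comp_continuousOn hf)
    (e.injective.comp_injOn hinj) (x := e x)
    (by rw [him, ← image_inter e.injective, ← image_singleton]; exact image_mono hKf)
    (hS.image e e.continuous.continuousOn) ((disjoint_image_iff e.injective).2 hSK)
    (mem_image_of_mem e ha) (mem_image_of_mem e hb)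
    (by rwa [him, e.injective.mem_set_image]) (by rwa [him, e.injective.mem_set_image])
  refine ⟨e ⁻¹' S', e.isPreconnected_preimage.2 h1, ?_, h3, h4⟩
  rw [him, ← image_union] at h2
  exact disjoint_left.2 fun z hz hz' => h2.le_bot ⟨hz, mem_image_of_mem e hz'⟩

/-- If a face of `K ∪ f '' [a, b]` touches an arc whose interior is disjoint from `K` at an
interior point, then its closure contains the endpoint of the arc. -/
theorem endpoint_mem_closure_component {K : Set (ℝ × ℝ)} (hK : IsCompact K)
    {f : ℝ → ℝ × ℝ} {a b t : ℝ} (hf : ContinuousOn f (Icc a b)) (hinj : InjOn f (Icc a b))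
    (hKf : ∀ s ∈ Ioo a b, f s ∉ K) (ht : t ∈ Ioo a b) {X : Set (ℝ × ℝ)}
    (hX : X = K ∪ f '' Icc a b) {x₀ : ℝ × ℝ}
    (htF : f t ∈ closure (connectedComponentIn Xᶜ x₀)) :
    f a ∈ closure (connectedComponentIn Xᶜ x₀) := by
  set F := connectedComponentIn Xᶜ x₀ with hF
  have hXc : IsClosed X := by
    rw [hX]; exact (hK.union (isCompact_Icc.image_of_continuousOn hf)).isClosed
  have hFo : IsOpen F := hXc.isOpen_compl.connectedComponentIn
  have hFX : ∀ z ∈ F, z ∉ X := fun z hz => connectedComponentIn_subset _ _ hz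
  suffices h : MapsTo f (Ioo a t) (closure F) by
    have := ContinuousWithinAt.mem_closure (x := a) (s := Ioo a t)
      ((hf a ⟨le_rfl, (ht.1.trans ht.2).le⟩).mono
        fun r hr => ⟨hr.1.le, (hr.2.trans ht.2).le⟩)
      (by rw [closure_Ioo ht.1.ne]; exact ⟨le_rfl, ht.1.le⟩) h
    rwa [closure_closure] at this
  intro s hs
  by_contra hsF
  have hsab : s ∈ Ioo a b := ⟨hs.1, hs.2.trans ht.2⟩
  have hnhds : ∀ᶠ r in 𝓝 s, f r ∈ (closure F)ᶜ :=
    (hf.continuousAt (Icc_mem_nhds hsab.1 hsab.2)).eventually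
      (isClosed_closure.isOpen_compl.mem_nhds hsF)
  obtain ⟨ε, hε, hN⟩ := Metric.eventually_nhds_iff.1 hnhds
  obtain ⟨s', hs'1, hs'2⟩ := exists_between (max_lt hs.1 (sub_lt_self s hε))
  obtain ⟨s₁, hs₁1, hs₁2⟩ := exists_between (lt_min hs.2 (lt_add_of_pos_right s hε))
  rw [max_lt_iff] at hs'1
  rw [lt_min_iff] at hs₁2
  obtain ⟨ht1, ht2⟩ := ht
  obtain ⟨hs1, hs2⟩ := hs
  obtain ⟨has', hεs'⟩ := hs'1
  obtain ⟨hs₁t, hεs₁⟩ := hs₁2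
  have hK'' : IsCompact (K ∪ f '' Icc a s') := hK.union (isCompact_Icc.image_of_continuousOn
    (hf.mono (Icc_subset_Icc_right (by linarith))))
  have hfree : ∀ r ∈ Ioc s' t, f r ∉ K ∪ f '' Icc a s' := by
    rintro r ⟨hr1, hr2⟩ (h | ⟨r', hr', h⟩)
    · exact hKf r ⟨by linarith, by linarith⟩ h
    · have := hinj ⟨hr'.1, by linarith [hr'.2]⟩ ⟨by linarith, by linarith⟩ h
      linarith [hr'.2]
  obtain ⟨r, hr, hball⟩ := Metric.isOpen_iff.1 hK''.isClosed.isOpen_compl (f t)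
    (hfree t ⟨by linarith, le_rfl⟩)
  obtain ⟨x, hxF, hx⟩ := Metric.mem_closure_iff.1 htF r hr
  have hSpre : IsPreconnected (Metric.ball (f t) r ∪ f '' Icc s t) :=
    ((convex_ball (f t) r).isPreconnected).union (f t) (Metric.mem_ball_self hr)
      (mem_image_of_mem f ⟨hs2.le, le_rfl⟩)
      (isPreconnected_Icc.image f (hf.mono (Icc_subset_Icc (by linarith) (by linarith))))
  obtain ⟨S', hS', hdis, hxS', hsS'⟩ := exists_isPreconnected_avoiding_arc hK''
    (c := s₁) (d := b) (by linarith) (hf.mono (Icc_subset_Icc_left (by linarith)))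
    (hinj.mono (Icc_subset_Icc_left (by linarith))) (x := f b)
    (by
      rintro _ ⟨hz, q, hq, rfl⟩
      rcases hq.2.eq_or_lt with rfl | hqb
      · rfl
      · exfalso
        rcases hz with h | ⟨r', hr', h⟩
        · exact hKf q ⟨by linarith [hq.1], hqb⟩ h
        · have := hinj ⟨hr'.1, by linarith [hr'.2]⟩ ⟨by linarith [hq.1], hq.2⟩ h
          linarith [hr'.2, hq.1])
    hSpre
    (by
      refine disjoint_left.2 ?_
      rintro z (hz | ⟨q, hq, rfl⟩)
      · exact hball hz
      · exact hfree q ⟨by linarith [hq.1], hq.2⟩)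
    (a := x) (b := f s) (Or.inl (by rwa [Metric.mem_ball, dist_comm]))
    (Or.inr (mem_image_of_mem f ⟨le_rfl, hs2.le⟩))
    (fun h => hFX x hxF (hX ▸ Or.inr (image_mono (Icc_subset_Icc_left (by linarith)) h)))
    (by
      rintro ⟨q, hq, h⟩
      have := hinj ⟨by linarith [hq.1], hq.2⟩ ⟨hs1.le, hsab.2.le⟩ h
      linarith [hq.1])
  obtain ⟨z, hzS', hzF, hzF'⟩ := exists_mem_closure_diff hS' hFo hxS' hxF hsS'
    (fun h => hsF (subset_closure h))
  have hzX : z ∈ X := by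
    by_contra h
    exact hzF' (closure_connectedComponentIn_inter_subset ⟨hzF, h⟩)
  have hz' : z ∉ (K ∪ f '' Icc a s') ∪ f '' Icc s₁ b := fun h => hdis.le_bot ⟨hzS', h⟩
  rw [hX] at hzX
  rcases hzX with hzK | ⟨q, hq, rfl⟩
  · exact hz' (Or.inl (Or.inl hzK))
  · have h1 : s' < q := by
      by_contra! h
      exact hz' (Or.inl (Or.inr (mem_image_of_mem f ⟨hq.1, h⟩)))
    have h2 : q < s₁ := by
      by_contra! h
      exact hz' (Or.inr (mem_image_of_mem f ⟨h, hq.2⟩))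
    exact hN (by rw [Real.dist_eq, abs_lt]; constructor <;> linarith) hzF

/-- Let `f` and `g` be simple arcs attached to a compact set `R` that cross exactly once. If `g` does
not return after the crossing to the face of `R ∪ f` it came from, then the initial points of
`f` and `g` lie on the boundary of a common face. -/
theorem exists_common_face_of_crossing {R : Set (ℝ × ℝ)} (hR : IsCompact R)
    {f g : ℝ → ℝ × ℝ} (hf : ContinuousOn f (Icc 0 1)) (hg : ContinuousOn g (Icc 0 1))
    (hfi : InjOn f (Icc 0 1)) (hgi : InjOn g (Icc 0 1))
    (hfR : ∀ t ∈ Ioo (0 : ℝ) 1, f t ∉ R) (hgR : ∀ t ∈ Ioo (0 : ℝ) 1, g t ∉ R)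
    (hf0 : f 0 ∈ R) (hg0 : g 0 ∈ R) (hg1 : g 1 ∈ R) {s₀ t₀ : ℝ} (hs₀ : s₀ ∈ Ioo (0 : ℝ) 1)
    (ht₀ : t₀ ∈ Ioo (0 : ℝ) 1) (hst : f s₀ = g t₀)
    (huniq : ∀ s ∈ Icc (0 : ℝ) 1, ∀ t ∈ Icc (0 : ℝ) 1, f s = g t → s = s₀ ∧ t = t₀)
    (hcross : ∀ t ∈ Ioo t₀ 1,
      g t ∉ connectedComponentIn (R ∪ f '' Icc 0 1)ᶜ (g (t₀ / 2))) :
    ∃ x ∉ R ∪ f '' Icc 0 1 ∪ g '' Icc 0 1,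
      f 0 ∈ closure (connectedComponentIn (R ∪ f '' Icc 0 1 ∪ g '' Icc 0 1)ᶜ x) ∧
      g 0 ∈ closure (connectedComponentIn (R ∪ f '' Icc 0 1 ∪ g '' Icc 0 1)ᶜ x) := by
  obtain ⟨hs1, hs2⟩ := hs₀
  obtain ⟨ht1, ht2⟩ := ht₀
  set X₁ := R ∪ f '' Icc 0 1 with hX₁
  set X := X₁ ∪ g '' Icc 0 1 with hX
  set D := connectedComponentIn X₁ᶜ (g (t₀ / 2)) with hD
  have hfc : IsCompact (f '' Icc 0 1) := isCompact_Icc.image_of_continuousOn hf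
  have hgc : IsCompact (g '' Icc 0 1) := isCompact_Icc.image_of_continuousOn hg
  have hX₁c : IsClosed X₁ := (hR.union hfc).isClosed
  have hXc : IsClosed X := ((hR.union hfc).union hgc).isClosed
  have hDo : IsOpen D := hX₁c.isOpen_compl.connectedComponentIn
  have hgX₁ : ∀ t ∈ Ioo (0 : ℝ) 1, t ≠ t₀ → g t ∉ X₁ := by
    rintro t ht hne (h | ⟨s, hs, h⟩)
    · exact hgR t ht h
    · exact hne (huniq s hs t ⟨ht.1.le, ht.2.le⟩ h).2
  have hδ : g '' Ioo 0 t₀ ⊆ D := by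
    refine IsPreconnected.subset_connectedComponentIn (isPreconnected_Ioo.image g
      (hg.mono fun t ht => ⟨ht.1.le, (ht.2.trans ht2).le⟩))
      (mem_image_of_mem g ⟨by linarith, by linarith⟩) ?_
    rintro _ ⟨t, ht, rfl⟩
    exact hgX₁ t ⟨ht.1, ht.2.trans ht2⟩ ht.2.ne
  have hDX : ∀ z ∈ D, z ∈ X → z ∈ g '' Ioo 0 t₀ := by
    intro z hzD hzX
    have hz1 : z ∉ X₁ := connectedComponentIn_subset _ _ hzD
    obtain ⟨t, ht, rfl⟩ := hzX.resolve_left hz1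
    have h0 : t ≠ 0 := by rintro rfl; exact hz1 (Or.inl hg0)
    have h1 : t ≠ 1 := by rintro rfl; exact hz1 (Or.inl hg1)
    refine mem_image_of_mem g ⟨ht.1.lt_of_ne' h0, lt_of_not_ge fun h => ?_⟩
    rcases h.eq_or_lt with rfl | h
    · exact hz1 (hst ▸ Or.inr (mem_image_of_mem f ⟨hs1.le, hs2.le⟩))
    · exact hcross t ⟨h, ht.2.lt_of_ne h1⟩ hzD
  have hpD : f s₀ ∈ closure D := by
    rw [hst]
    refine ContinuousWithinAt.mem_closure (s := Ioo 0 t₀)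
      ((hg t₀ ⟨ht1.le, ht2.le⟩).mono fun t ht => ⟨ht.1.le, (ht.2.trans ht2).le⟩)
      (by rw [closure_Ioo ht1.ne]; exact ⟨ht1.le, le_rfl⟩) (mapsTo_iff_image_subset.2 hδ)
  have himage : ∀ (h : ℝ → ℝ × ℝ) (c : ℝ), c ∈ Ioo (0 : ℝ) 1 →
      h '' Icc 0 1 = h '' Icc 0 c ∪ h '' Icc c 1 := fun h c hc => by
    rw [← image_union, Icc_union_Icc_eq_Icc hc.1.le hc.2.le]
  have hsub : ∀ (h : ℝ → ℝ × ℝ) (c d : ℝ), 0 ≤ c → d ≤ 1 → ContinuousOn h (Icc 0 1) →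
      ContinuousOn h (Icc c d) := fun h c d hc hd hh => hh.mono (Icc_subset_Icc hc hd)
  obtain ⟨s₂, hs₂, hxD⟩ : ∃ s ∈ Ioo 0 s₀, f s ∈ closure D := by
    refine ⟨s₀ / 2, ⟨by linarith, by linarith⟩, ?_⟩
    refine endpoint_mem_closure_component
      (hR.union (isCompact_Icc.image_of_continuousOn (hsub f 0 (s₀ / 2) le_rfl (by linarith) hf)))
      (hsub f (s₀ / 2) 1 (by linarith) le_rfl hf)
      (hfi.mono (Icc_subset_Icc_left (by linarith))) ?_ ⟨by linarith, hs2⟩ ?_ hpD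
    · rintro s hs (h | ⟨r, hr, h⟩)
      · exact hfR s ⟨by linarith [hs.1], hs.2⟩ h
      · have := hfi ⟨hr.1, by linarith [hr.2]⟩ ⟨by linarith [hs.1], hs.2.le⟩ h
        linarith [hr.2, hs.1]
    · rw [hX₁, himage f (s₀ / 2) ⟨by linarith, by linarith⟩, union_assoc]
  have hfs₂ : f s₂ ∉ R ∪ g '' Icc 0 1 ∪ f '' Icc s₀ 1 := by
    rintro ((h | ⟨t, ht, h⟩) | ⟨r, hr, h⟩)
    · exact hfR s₂ ⟨hs₂.1, hs₂.2.trans hs2⟩ h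
    · exact hs₂.2.ne (huniq s₂ ⟨hs₂.1.le, (hs₂.2.trans hs2).le⟩ t ht h.symm).1
    · have := hfi ⟨by linarith [hr.1], hr.2⟩ ⟨hs₂.1.le, (hs₂.2.trans hs2).le⟩ h
      linarith [hr.1, hs₂.2]
  obtain ⟨r, hr, hball⟩ := Metric.isOpen_iff.1 ((hR.union hgc).union
    (isCompact_Icc.image_of_continuousOn (hsub f s₀ 1 hs1.le le_rfl hf))).isClosed.isOpen_compl
    (f s₂) hfs₂
  obtain ⟨y, hyD, hy⟩ := Metric.mem_closure_iff.1 hxD r hr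
  have hyball : y ∈ Metric.ball (f s₂) r := by rwa [Metric.mem_ball, dist_comm]
  have hyX : y ∉ X := by
    rintro (h | h)
    · exact connectedComponentIn_subset _ _ hyD h
    · exact hball hyball (Or.inl (Or.inr h))
  set F := connectedComponentIn Xᶜ y with hF
  have hFo : IsOpen F := hXc.isOpen_compl.connectedComponentIn
  have hyF : y ∈ F := mem_connectedComponentIn hyX
  have hFX : ∀ z ∈ F, z ∉ X := fun z hz => connectedComponentIn_subset _ _ hz
  have hfrontier : ∀ z ∈ closure F, z ∉ F → z ∈ X := fun z hz hz' => by
    by_contra h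
    exact hz' (closure_connectedComponentIn_inter_subset ⟨hz, h⟩)
  refine ⟨y, hyX, ?_, ?_⟩
  · obtain ⟨z, hzb, hzF, hzF'⟩ := exists_mem_closure_diff
      (convex_ball (f s₂) r).isPreconnected hFo hyball hyF (Metric.mem_ball_self hr)
      (fun h => hFX _ h (Or.inl (Or.inr
        (mem_image_of_mem f ⟨hs₂.1.le, (hs₂.2.trans hs2).le⟩))))
    have hz := hball hzb
    obtain ⟨s, hs, rfl⟩ : z ∈ f '' Icc 0 1 := by
      rcases hfrontier z hzF hzF' with (h | h) | h
      · exact absurd (Or.inl (Or.inl h)) hz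
      · exact h
      · exact absurd (Or.inl (Or.inr h)) hz
    have h0 : s ≠ 0 := by rintro rfl; exact hz (Or.inl (Or.inl hf0))
    have h1 : s < s₀ := by
      by_contra! h
      exact hz (Or.inr (mem_image_of_mem f ⟨h, hs.2⟩))
    refine endpoint_mem_closure_component ((hR.union hgc).union
      (isCompact_Icc.image_of_continuousOn (hsub f s₀ 1 hs1.le le_rfl hf)))
      (hsub f 0 s₀ le_rfl hs2.le hf) (hfi.mono (Icc_subset_Icc_right hs2.le)) ?_
      ⟨hs.1.lt_of_ne' h0, h1⟩ ?_ hzF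
    · rintro q hq ((h | ⟨t, ht, h⟩) | ⟨r, hr, h⟩)
      · exact hfR q ⟨hq.1, hq.2.trans hs2⟩ h
      · exact hq.2.ne (huniq q ⟨hq.1.le, (hq.2.trans hs2).le⟩ t ht h.symm).1
      · have := hfi ⟨by linarith [hr.1], hr.2⟩ ⟨hq.1.le, (hq.2.trans hs2).le⟩ h
        linarith [hr.1, hq.2]
    · rw [hX, hX₁, himage f s₀ ⟨hs1, hs2⟩]
      ac_rfl
  · have hFD : F ⊆ D := by
      rw [hD, connectedComponentIn_eq hyD]
      exact connectedComponentIn_mono _ (compl_subset_compl.2 subset_union_left)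
    have hgD : g (t₀ / 2) ∈ g '' Ioo 0 t₀ := mem_image_of_mem g ⟨by linarith, by linarith⟩
    obtain ⟨z, hzD, hzF, hzF'⟩ := exists_mem_closure_diff
      isPreconnected_connectedComponentIn hFo hyD hyF (hδ hgD)
      (fun h => hFX _ h (Or.inr (mem_image_of_mem g ⟨by linarith, by linarith⟩)))
    obtain ⟨t, ht, rfl⟩ := hDX z hzD (hfrontier z hzF hzF')
    refine endpoint_mem_closure_component ((hR.union hfc).union
      (isCompact_Icc.image_of_continuousOn (hsub g t₀ 1 ht1.le le_rfl hg)))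
      (hsub g 0 t₀ le_rfl ht2.le hg) (hgi.mono (Icc_subset_Icc_right ht2.le)) ?_ ht ?_ hzF
    · rintro q hq (h | ⟨r, hr, h⟩)
      · exact hgX₁ q ⟨hq.1, hq.2.trans ht2⟩ hq.2.ne h
      · have := hgi ⟨by linarith [hr.1], hr.2⟩ ⟨hq.1.le, (hq.2.trans ht2).le⟩ h
        linarith [hr.1, hq.2]
    · rw [hX, hX₁, himage g t₀ ⟨ht1, ht2⟩]
      ac_rfl

variable {V : Type*} {G : SimpleGraph V} {u v : V}

/-- Greedy selection: if the conflicts exclude fewer than `card κ` values at every index, then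
there is a conflict-free choice. -/
theorem exists_avoiding_choice {ι κ : Type*} [Fintype ι] [DecidableEq ι] [Fintype κ]
    {conf : ι → ι → Prop} [DecidableRel conf] {bad : ι → κ → ι → κ → Prop} {B : ι → Finset κ}
    {d m b : ℕ} (hconf : ∀ i i', conf i i' → conf i' i) (hirr : ∀ i, ¬conf i i)
    (hsymm : ∀ i j i' j', bad i j i' j' → bad i' j' i j)
    (hd : ∀ i, (Finset.univ.filter (conf i)).card ≤ d)
    (hm : ∀ i i' j', conf i i' → ∃ s : Finset κ, s.card ≤ m ∧ ∀ j, bad i j i' j' → j ∈ s)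
    (hb : ∀ i, (B i).card ≤ b) (hcard : d * m + b < Fintype.card κ) :
    ∃ c : ι → κ, ∀ i, c i ∉ B i ∧ ∀ i', conf i i' → ¬bad i (c i) i' (c i') := by
  classical
  suffices h : ∀ s : Finset ι, ∃ c : ι → κ, ∀ i ∈ s, c i ∉ B i ∧
      ∀ i' ∈ s, conf i i' → ¬bad i (c i) i' (c i') by
    obtain ⟨c, hc⟩ := h Finset.univ
    exact ⟨c, fun i => ⟨(hc i (Finset.mem_univ _)).1, fun i' =>
      (hc i (Finset.mem_univ _)).2 i' (Finset.mem_univ _)⟩⟩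
  intro s
  induction s using Finset.induction_on with
  | empty =>
    have : Nonempty κ := Fintype.card_pos_iff.1 (by omega)
    exact ⟨fun _ => Classical.choice this, by simp⟩
  | insert a s ha ih =>
    obtain ⟨c, hc⟩ := ih
    have hm' : ∀ i', ∃ t : Finset κ, conf a i' →
        t.card ≤ m ∧ ∀ j, bad a j i' (c i') → j ∈ t := fun i' => by
      by_cases h : conf a i'
      · obtain ⟨t, ht⟩ := hm a i' (c i') h
        exact ⟨t, fun _ => ht⟩
      · exact ⟨∅, fun h' => absurd h' h⟩
    choose t ht using hm'
    have hlt : (B a ∪ (Finset.univ.filter (conf a)).biUnion t).card < Fintype.card κ := by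
      have h1 := Finset.card_union_le (B a) ((Finset.univ.filter (conf a)).biUnion t)
      have h2 := Finset.card_biUnion_le_card_mul (Finset.univ.filter (conf a)) t m
        (fun i' hi' => (ht i' (Finset.mem_filter.1 hi').2).1)
      have h3 := Nat.mul_le_mul_right m (hd a)
      have h4 := hb a
      omega
    obtain ⟨j, hj⟩ : ∃ j, j ∉ B a ∪ (Finset.univ.filter (conf a)).biUnion t := by
      by_contra! h
      exact hlt.ne (Finset.card_eq_iff_eq_univ _ |>.2 (Finset.eq_univ_iff_forall.2 h))
    have hjB : j ∉ B a := fun h => hj (Finset.mem_union_left _ h)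
    have hjbad : ∀ i', conf a i' → ¬bad a j i' (c i') := fun i' hi' hbad =>
      hj (Finset.mem_union_right _ (Finset.mem_biUnion.2
        ⟨i', Finset.mem_filter.2 ⟨Finset.mem_univ _, hi'⟩, (ht i' hi').2 j hbad⟩))
    refine ⟨Function.update c a j, fun i hi => ?_⟩
    rcases eq_or_ne i a with rfl | hia
    · rw [Function.update_self]
      refine ⟨hjB, fun i' _ hii' => ?_⟩
      have : i' ≠ i := by rintro rfl; exact hirr _ hii'
      rw [Function.update_of_ne this]
      exact hjbad i' hii'
    · have his := (Finset.mem_insert.1 hi).resolve_left hia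
      rw [Function.update_of_ne hia]
      refine ⟨(hc i his).1, fun i' hi' hii' => ?_⟩
      rcases eq_or_ne i' a with rfl | hia'
      · rw [Function.update_self]
        exact fun h => hjbad i (hconf _ _ hii') (hsymm _ _ _ _ h)
      · rw [Function.update_of_ne hia']
        exact (hc i his).2 i' ((Finset.mem_insert.1 hi').resolve_left hia') hii'

theorem IsArc.joinedIn {A : Set (ℝ × ℝ)} {x y : ℝ × ℝ} (h : IsArc A x y) : JoinedIn A x y := by
  obtain ⟨f, hf, -, h0, h1, rfl⟩ := h
  exact ⟨⟨⟨f, hf⟩, h0, h1⟩, fun t => mem_range_self t⟩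

theorem IsArc.isCompact {A : Set (ℝ × ℝ)} {x y : ℝ × ℝ} (h : IsArc A x y) : IsCompact A := by
  obtain ⟨f, hf, -, -, -, rfl⟩ := h
  exact isCompact_range hf

theorem IsArc.exists_parametrization {A : Set (ℝ × ℝ)} {x y : ℝ × ℝ} (h : IsArc A x y) :
    ∃ f : ℝ → ℝ × ℝ, ContinuousOn f (Icc 0 1) ∧ InjOn f (Icc 0 1) ∧ f 0 = x ∧ f 1 = y ∧
      f '' Icc 0 1 = A := by
  obtain ⟨f, hf, hfi, h0, h1, rfl⟩ := h
  refine ⟨IccExtend zero_le_one f, hf.Icc_extend'.continuousOn, fun s hs t ht hst => ?_, ?_, ?_, ?_⟩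
  · rw [IccExtend_of_mem _ _ hs, IccExtend_of_mem _ _ ht] at hst
    exact congrArg Subtype.val (hfi hst)
  · rw [IccExtend_left]; exact h0
  · rw [IccExtend_right]; exact h1
  · ext p
    constructor
    · rintro ⟨t, -, rfl⟩
      exact mem_range_self _
    · rintro ⟨t, rfl⟩
      exact ⟨t, t.2, IccExtend_val _ _ t⟩

theorem Drawing.notMem_range_pos_of_mem_Ioo (D : Drawing G) {a b : V} (hab : G.Adj a b)
    {f : ℝ → ℝ × ℝ} (hfi : InjOn f (Icc 0 1)) (h0 : f 0 = D.pos a) (h1 : f 1 = D.pos b)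
    (hf : f '' Icc 0 1 = D.arc s(a, b)) {t : ℝ} (ht : t ∈ Ioo (0 : ℝ) 1) :
    f t ∉ range D.pos := by
  rintro ⟨w, hw⟩
  have htI : t ∈ Icc (0 : ℝ) 1 := Ioo_subset_Icc_self ht
  have hwe := D.arc_avoid s(a, b) hab w (hw ▸ hf ▸ mem_image_of_mem f htI)
  rcases Sym2.mem_iff.1 hwe with rfl | rfl
  · exact ht.1.ne (hfi (by simp) htI (h0.trans hw))
  · exact ht.2.ne' (hfi (by simp) htI (h1.trans hw))

theorem Drawing.Crosses.symm {D : Drawing G} {e e' : Sym2 V} {p : ℝ × ℝ}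
    (h : D.Crosses e e' p) : D.Crosses e' e p :=
  ⟨h.2.1, h.1, h.2.2.1.symm, h.2.2.2.2.1, h.2.2.2.1, h.2.2.2.2.2⟩

theorem Drawing.crosses_of_mem (D : Drawing G) {e e' : Sym2 V} (he : e ∈ G.edgeSet)
    (he' : e' ∈ G.edgeSet) (hdisj : ∀ w ∈ e, w ∉ e') {p : ℝ × ℝ} (hp : p ∈ D.arc e)
    (hp' : p ∈ D.arc e') : D.Crosses e e' p := by
  refine ⟨he, he', ?_, hp, hp', ?_⟩
  · rintro rfl
    induction e with | _ a b => exact hdisj a (Sym2.mem_mk_left a b) (Sym2.mem_mk_left a b)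
  · rintro ⟨w, rfl⟩
    exact hdisj w (D.arc_avoid e he w hp) (D.arc_avoid e' he' w hp')

theorem Drawing.joinedIn_arc (D : Drawing G) {a b : V} (h : G.Adj a b) :
    JoinedIn (D.arc s(a, b)) (D.pos a) (D.pos b) :=
  (D.arc_curve _ h a b rfl).joinedIn

namespace Fence

/-- The branch vertices of a fence. -/
def branch (F : Fence G u v) : Fin 5 → V := ![u, v, F.w₁, F.w₂, F.w₃]

/-- The indices of the endpoints of the bundles of a fence. -/
def ends : Fin 8 → Fin 5 × Fin 5 :=
  ![(0, 1), (0, 2), (0, 4), (1, 3), (1, 4), (2, 3), (2, 4), (3, 4)]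

/-- Two bundles of a fence whose endpoints are disjoint. -/
def Opposite (i i' : Fin 8) : Prop :=
  (ends i).1 ≠ (ends i').1 ∧ (ends i).1 ≠ (ends i').2 ∧
    (ends i).2 ≠ (ends i').1 ∧ (ends i).2 ≠ (ends i').2

instance : DecidableRel Opposite := fun _ _ => inferInstanceAs (Decidable (_ ∧ _))

variable (F : Fence G u v) (D : Drawing G)

theorem branch_injective : Function.Injective F.branch := F.branch_inj

theorem mid_ne_branch (i : Fin 8) (j : Fin 12) (k : Fin 5) : F.mid i j ≠ F.branch k := by
  intro h
  apply F.mid_not_branch i j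
  rw [h]
  fin_cases k <;> simp [branch]

theorem mid_inj_iff {i i' : Fin 8} {j j' : Fin 12} :
    F.mid i j = F.mid i' j' ↔ i = i' ∧ j = j' := by
  refine ⟨fun h => ?_, by rintro ⟨rfl, rfl⟩; rfl⟩
  simpa using F.mid_inj (a₁ := (i, j)) (a₂ := (i', j')) h

theorem fenceEnds_eq (i : Fin 8) : fenceEnds u v F.w₁ F.w₂ F.w₃ i =
    (F.branch (ends i).1, F.branch (ends i).2) := by
  fin_cases i <;> rfl

theorem adj_left (i : Fin 8) (j : Fin 12) : G.Adj (F.branch (ends i).1) (F.mid i j) := by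
  simpa [fenceEnds_eq] using (F.bundles i j).1

theorem adj_right (i : Fin 8) (j : Fin 12) : G.Adj (F.mid i j) (F.branch (ends i).2) := by
  simpa [fenceEnds_eq] using (F.bundles i j).2

/-- The curve of the `j`-th path of the `i`-th bundle of a fence. -/
def path (i : Fin 8) (j : Fin 12) : Set (ℝ × ℝ) :=
  D.arc s(F.branch (ends i).1, F.mid i j) ∪ D.arc s(F.mid i j, F.branch (ends i).2)

theorem joinedIn_path (i : Fin 8) (j : Fin 12) :
    JoinedIn (F.path D i j) (D.pos (F.branch (ends i).1)) (D.pos (F.branch (ends i).2)) :=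
  ((D.joinedIn_arc (F.adj_left i j)).mono subset_union_left).trans
    ((D.joinedIn_arc (F.adj_right i j)).mono subset_union_right)

theorem exists_edge_of_mem_path {i : Fin 8} {j : Fin 12} {p : ℝ × ℝ} (hp : p ∈ F.path D i j) :
    ∃ e ∈ G.edgeSet, p ∈ D.arc e ∧ F.mid i j ∈ e ∧
      ∀ w ∈ e, w = F.mid i j ∨ w = F.branch (ends i).1 ∨ w = F.branch (ends i).2 := by
  rcases hp with hp | hp
  · exact ⟨_, F.adj_left i j, hp, Sym2.mem_mk_right _ _, fun w hw => by
      rw [Sym2.mem_iff] at hw; tauto⟩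
  · exact ⟨_, F.adj_right i j, hp, Sym2.mem_mk_left _ _, fun w hw => by
      rw [Sym2.mem_iff] at hw; tauto⟩

variable {D}

/-- At most one path of a bundle meets a given edge that is vertex-disjoint from the bundle. -/
theorem exists_card_le_one (hD : D.IsOnePlanar) (i : Fin 8) {e : Sym2 V} (he : e ∈ G.edgeSet)
    (h1 : F.branch (ends i).1 ∉ e) (h2 : F.branch (ends i).2 ∉ e) (hmid : ∀ j, F.mid i j ∉ e) :
    ∃ s : Finset (Fin 12), s.card ≤ 1 ∧ ∀ j, ¬Disjoint (F.path D i j) (D.arc e) → j ∈ s := by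
  classical
  refine ⟨Finset.univ.filter fun j => ¬Disjoint (F.path D i j) (D.arc e), ?_, by simp⟩
  have key : ∀ j, ¬Disjoint (F.path D i j) (D.arc e) → ∃ e' p, D.Crosses e e' p ∧
      F.mid i j ∈ e' ∧
      ∀ w ∈ e', w = F.mid i j ∨ w = F.branch (ends i).1 ∨ w = F.branch (ends i).2 := by
    intro j hj
    obtain ⟨p, hp, hpe⟩ := not_disjoint_iff.1 hj
    obtain ⟨e', he', hpe', hm, hw⟩ := F.exists_edge_of_mem_path D hp
    refine ⟨e', p, (D.crosses_of_mem he' he (fun w hwe' => ?_) hpe' hpe).symm, hm, hw⟩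
    rcases hw w hwe' with rfl | rfl | rfl
    exacts [hmid j, h1, h2]
  refine Finset.card_le_one.2 fun j hj j' hj' => ?_
  obtain ⟨e₁, p₁, hc₁, hm₁, -⟩ := key j (Finset.mem_filter.1 hj).2
  obtain ⟨e₂, p₂, hc₂, -, hw₂⟩ := key j' (Finset.mem_filter.1 hj').2
  obtain ⟨rfl, -⟩ := hD.1 _ _ _ _ _ hc₁ hc₂
  rcases hw₂ _ hm₁ with h | h | h
  · exact (F.mid_inj_iff.1 h).2
  · exact absurd h (F.mid_ne_branch _ _ _)
  · exact absurd h (F.mid_ne_branch _ _ _)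

theorem exists_card_le_two (hD : D.IsOnePlanar) {i i' : Fin 8} (j' : Fin 12)
    (hii' : Opposite i i') : ∃ s : Finset (Fin 12), s.card ≤ 2 ∧
      ∀ j, ¬Disjoint (F.path D i j) (F.path D i' j') → j ∈ s := by
  obtain ⟨h1, h2, h3, h4⟩ := hii'
  have hne : i ≠ i' := by rintro rfl; exact h1 rfl
  have hb := fun k => (F.mid_ne_branch i' j' k).symm
  have hb' := F.mid_ne_branch i
  have hinj := fun a b => F.branch_injective.eq_iff (a := a) (b := b)
  obtain ⟨s, hs, hs'⟩ := F.exists_card_le_one hD i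
    (e := s(F.branch (ends i').1, F.mid i' j')) (F.adj_left i' j')
    (by simp [Sym2.mem_iff, hb, hinj, h1]) (by simp [Sym2.mem_iff, hb, hinj, h3])
    (fun j => by simp [Sym2.mem_iff, hb', F.mid_inj_iff, hne])
  obtain ⟨t, ht, ht'⟩ := F.exists_card_le_one hD i
    (e := s(F.mid i' j', F.branch (ends i').2)) (F.adj_right i' j')
    (by simp [Sym2.mem_iff, hb, hinj, h2]) (by simp [Sym2.mem_iff, hb, hinj, h4])
    (fun j => by simp [Sym2.mem_iff, hb', F.mid_inj_iff, hne])
  refine ⟨s ∪ t, (Finset.card_union_le _ _).trans (by omega), fun j hj => ?_⟩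
  rw [path, path, disjoint_union_right, ← path, not_and_or] at hj
  exact Finset.mem_union.2 (hj.imp (hs' j) (ht' j))

theorem exists_card_le_one_of_branch (hD : D.IsOnePlanar) {a b : Fin 5}
    (hab : G.Adj (F.branch a) (F.branch b)) (i : Fin 8) :
    ∃ s : Finset (Fin 12), s.card ≤ 1 ∧
      ∀ j, (ends i).1 ≠ a → (ends i).1 ≠ b → (ends i).2 ≠ a → (ends i).2 ≠ b →
        ¬Disjoint (F.path D i j) (D.arc s(F.branch a, F.branch b)) → j ∈ s := by
  have hinj := fun a b => F.branch_injective.eq_iff (a := a) (b := b)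
  by_cases h : (ends i).1 ≠ a ∧ (ends i).1 ≠ b ∧ (ends i).2 ≠ a ∧ (ends i).2 ≠ b
  · obtain ⟨h1, h2, h3, h4⟩ := h
    obtain ⟨s, hs, hs'⟩ := F.exists_card_le_one hD i (e := s(F.branch a, F.branch b)) hab
      (by simp [Sym2.mem_iff, hinj, h1, h2]) (by simp [Sym2.mem_iff, hinj, h3, h4])
      (fun j => by simp [Sym2.mem_iff, F.mid_ne_branch])
    exact ⟨s, hs, fun j _ _ _ _ => hs' j⟩
  · exact ⟨∅, by simp, fun j h1 h2 h3 h4 => absurd ⟨h1, h2, h3, h4⟩ h⟩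

/-- One path can be selected from each bundle so that paths of opposite bundles are disjoint and
no selected path meets a single edge that is vertex-disjoint from its bundle. -/
theorem exists_disjoint_paths (hD : D.IsOnePlanar) : ∃ c : Fin 8 → Fin 12, ∀ i,
    (∀ i', Opposite i i' → Disjoint (F.path D i (c i)) (F.path D i' (c i'))) ∧
    ((ends i).1 ≠ 0 → (ends i).1 ≠ 3 → (ends i).2 ≠ 0 → (ends i).2 ≠ 3 →
      Disjoint (F.path D i (c i)) (D.arc s(u, F.w₂))) ∧
    ((ends i).1 ≠ 1 → (ends i).1 ≠ 2 → (ends i).2 ≠ 1 → (ends i).2 ≠ 2 →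
      Disjoint (F.path D i (c i)) (D.arc s(v, F.w₁))) := by
  choose s hs hs' using F.exists_card_le_one_of_branch hD (a := 0) (b := 3) F.single₁
  choose t ht ht' using F.exists_card_le_one_of_branch hD (a := 1) (b := 2) F.single₂
  obtain ⟨c, hc⟩ := exists_avoiding_choice (conf := Opposite)
    (bad := fun i j i' j' => ¬Disjoint (F.path D i j) (F.path D i' j'))
    (B := fun i => s i ∪ t i) (d := 3) (m := 2) (b := 2) (by decide) (by decide)
    (fun i j i' j' h h' => h h'.symm) (by decide)
    (fun i i' j' h => F.exists_card_le_two hD j' h)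
    (fun i => (Finset.card_union_le _ _).trans (Nat.add_le_add (hs i) (ht i)))
    (by simp)
  refine ⟨c, fun i => ⟨fun i' h => not_not.1 ((hc i).2 i' h), fun h1 h2 h3 h4 => ?_,
    fun h1 h2 h3 h4 => ?_⟩⟩
  · by_contra h
    exact (hc i).1 (Finset.mem_union_left _ (hs' i _ h1 h2 h3 h4 h))
  · by_contra h
    exact (hc i).1 (Finset.mem_union_right _ (ht' i _ h1 h2 h3 h4 h))

/-- The single edge `v w₁` cannot be rerouted without crossing the single edge `u w₂`. -/
theorem not_disjoint_reroute (hD : D.IsOnePlanar) {B : Set (ℝ × ℝ)}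
    (hB : JoinedIn B (D.pos v) (D.pos F.w₁))
    (hBarc : ∀ p ∈ B, ∀ e ∈ G.edgeSet, p ∈ D.arc e → p ∈ D.arc s(v, F.w₁)) :
    ¬Disjoint (D.arc s(u, F.w₂)) B := by
  intro hAB
  obtain ⟨c, hc⟩ := F.exists_disjoint_paths hD
  have hBP : ∀ i, (ends i).1 ≠ 1 → (ends i).1 ≠ 2 → (ends i).2 ≠ 1 → (ends i).2 ≠ 2 →
      Disjoint (F.path D i (c i)) B := by
    intro i h1 h2 h3 h4
    refine disjoint_left.2 fun p hp hpB => ?_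
    obtain ⟨e, he, hpe, -⟩ := F.exists_edge_of_mem_path D hp
    exact ((hc i).2.2 h1 h2 h3 h4).le_bot ⟨hp, hBarc p hpB e he hpe⟩
  refine K5_not_planar (fun k => D.pos (F.branch k)) (fun a b => {p |
    ((a, b) = (0, 3) ∧ p ∈ D.arc s(u, F.w₂)) ∨ ((a, b) = (1, 2) ∧ p ∈ B) ∨
    ∃ i, ends i = (a, b) ∧ p ∈ F.path D i (c i)}) ?_ ?_
  · intro a b hab
    have : (a, b) = (0, 3) ∨ (a, b) = (1, 2) ∨ ∃ i, ends i = (a, b) := by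
      clear * - hab; decide +revert
    rcases this with h | h | ⟨i, h⟩
    · obtain ⟨rfl, rfl⟩ := Prod.mk.inj h
      exact (D.joinedIn_arc F.single₁).mono fun p hp => Or.inl ⟨rfl, hp⟩
    · obtain ⟨rfl, rfl⟩ := Prod.mk.inj h
      exact hB.mono fun p hp => Or.inr (Or.inl ⟨rfl, hp⟩)
    · have := F.joinedIn_path D i (c i)
      rw [h] at this
      exact this.mono fun p hp => Or.inr (Or.inr ⟨i, h, hp⟩)
  · intro a b k l _ _ hak hal hbk hbl
    refine disjoint_left.2 ?_
    rintro p (⟨h, hp⟩ | ⟨h, hp⟩ | ⟨i, h, hp⟩) (⟨h', hp'⟩ | ⟨h', hp'⟩ | ⟨i', h', hp'⟩) <;>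
      obtain ⟨h₁, h₂⟩ := Prod.ext_iff.1 h <;> obtain ⟨h₁', h₂'⟩ := Prod.ext_iff.1 h' <;>
      simp only at h₁ h₂ h₁' h₂' <;> subst h₁ h₂ h₁' h₂'
    · exact hak rfl
    · exact hAB.le_bot ⟨hp, hp'⟩
    · exact ((hc i').2.1 hak.symm hbk.symm hal.symm hbl.symm).le_bot ⟨hp', hp⟩
    · exact hAB.le_bot ⟨hp', hp⟩
    · exact hak rfl
    · exact (hBP i' hak.symm hbk.symm hal.symm hbl.symm).le_bot ⟨hp', hp⟩
    · exact ((hc i).2.1 hak hal hbk hbl).le_bot ⟨hp, hp'⟩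
    · exact (hBP i hak hal hbk hbl).le_bot ⟨hp, hp'⟩
    · exact ((hc i).1 i' ⟨hak, hal, hbk, hbl⟩).le_bot ⟨hp, hp'⟩

/-- The two single edges of a fence cross in every 1-planar drawing. -/
theorem exists_crosses (hD : D.IsOnePlanar) : ∃ p, D.Crosses s(u, F.w₂) s(v, F.w₁) p := by
  have hinj := fun a b => F.branch_injective.ne_iff (x := a) (y := b)
  have h1 : u ≠ v := (hinj 0 1).2 (by decide)
  have h2 : u ≠ F.w₁ := (hinj 0 2).2 (by decide)
  have h3 : F.w₂ ≠ v := (hinj 3 1).2 (by decide)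
  have h4 : F.w₂ ≠ F.w₁ := (hinj 3 2).2 (by decide)
  have hdis : ∀ w ∈ s(u, F.w₂), w ∉ s(v, F.w₁) := by
    simp only [Sym2.mem_iff]
    rintro w (rfl | rfl) (h | h) <;> contradiction
  obtain ⟨p, hp, hp'⟩ := not_disjoint_iff.1 (F.not_disjoint_reroute hD
    (D.joinedIn_arc F.single₂) (B := D.arc s(v, F.w₁)) fun p hp _ _ _ => hp)
  exact ⟨p, D.crosses_of_mem F.single₁ F.single₂ hdis hp hp'⟩

/-- The vertices `u` and `v` of a fence lie on a common face of every 1-planar drawing. -/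
theorem cofacial [Finite V] {G : SimpleGraph V} {D : Drawing G} (F : Fence G u v)
    (hD : D.IsOnePlanar) : D.Cofacial u v := by
  obtain ⟨p, hp⟩ := F.exists_crosses hD
  have hdis := hD.2 _ _ _ hp
  obtain ⟨heA, heB, -, hpA, hpB, hpV⟩ := id hp
  obtain ⟨f, hf, hfi, hf0, hf1, hfA⟩ := (D.arc_curve _ heA _ _ rfl).exists_parametrization
  obtain ⟨g, hg, hgi, hg0, hg1, hgB⟩ := (D.arc_curve _ heB _ _ rfl).exists_parametrization
  have hfV := fun t => D.notMem_range_pos_of_mem_Ioo F.single₁ hfi hf0 hf1 hfA (t := t)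
  have hgV := fun t => D.notMem_range_pos_of_mem_Ioo F.single₂ hgi hg0 hg1 hgB (t := t)
  set R : Set (ℝ × ℝ) := range D.pos ∪
    ⋃ e ∈ G.edgeSet \ {s(u, F.w₂), s(v, F.w₁)}, D.arc e with hRdef
  have hmemR : ∀ e ∈ G.edgeSet, e ≠ s(u, F.w₂) → e ≠ s(v, F.w₁) → D.arc e ⊆ R :=
    fun e he h1 h2 q hq => Or.inr (mem_iUnion₂.2 ⟨e, ⟨he, by simp [h1, h2]⟩, hq⟩)
  have hR : IsCompact R := by
    refine (finite_range D.pos).isCompact.union ((toFinite _).isCompact_biUnion fun e he => ?_)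
    induction e with | _ a b => exact (D.arc_curve _ he.1 a b rfl).isCompact
  have hcases : ∀ q ∈ R, q ∈ range D.pos ∨
      ∃ e ∈ G.edgeSet, e ≠ s(u, F.w₂) ∧ e ≠ s(v, F.w₁) ∧ q ∈ D.arc e := by
    rintro q (hq | hq)
    · exact Or.inl hq
    · obtain ⟨e, ⟨he, hne⟩, hqe⟩ := mem_iUnion₂.1 hq
      simp only [mem_insert_iff, mem_singleton_iff, not_or] at hne
      exact Or.inr ⟨e, he, hne.1, hne.2, hqe⟩
  have himage : R ∪ f '' Icc 0 1 ∪ g '' Icc 0 1 = D.image := by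
    rw [hfA, hgB]
    refine Subset.antisymm ?_ ?_
    · rintro q ((hq | hq) | hq)
      · exact (hcases q hq).imp id fun ⟨e, he, _, _, hqe⟩ => mem_iUnion₂.2 ⟨e, he, hqe⟩
      · exact Or.inr (mem_iUnion₂.2 ⟨_, heA, hq⟩)
      · exact Or.inr (mem_iUnion₂.2 ⟨_, heB, hq⟩)
    · rintro q (hq | hq)
      · exact Or.inl (Or.inl (Or.inl hq))
      · obtain ⟨e, he, hqe⟩ := mem_iUnion₂.1 hq
        by_cases h1 : e = s(u, F.w₂)
        · exact Or.inl (Or.inr (h1 ▸ hqe))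
        · by_cases h2 : e = s(v, F.w₁)
          · exact Or.inr (h2 ▸ hqe)
          · exact Or.inl (Or.inl (hmemR e he h1 h2 hqe))
  have hfR : ∀ t ∈ Ioo (0 : ℝ) 1, f t ∉ R := by
    intro t ht hq
    obtain ⟨e, he, h1, h2, hqe⟩ := (hcases _ hq).resolve_left (hfV t ht)
    exact h2 (hD.1 _ _ _ _ _ ⟨heA, he, h1.symm,
      hfA ▸ mem_image_of_mem f (Ioo_subset_Icc_self ht), hqe, hfV t ht⟩ hp).1
  have hgR : ∀ t ∈ Ioo (0 : ℝ) 1, g t ∉ R := by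
    intro t ht hq
    obtain ⟨e, he, h1, h2, hqe⟩ := (hcases _ hq).resolve_left (hgV t ht)
    exact h1 (hD.1 _ _ _ _ _ ⟨heB, he, h2.symm,
      hgB ▸ mem_image_of_mem g (Ioo_subset_Icc_self ht), hqe, hgV t ht⟩ hp.symm).1
  have hposR : ∀ w, D.pos w ∈ R := fun w => Or.inl (mem_range_self w)
  have hIoo : ∀ (h : ℝ → ℝ × ℝ) (a b : V), h 0 = D.pos a → h 1 = D.pos b → ∀ t ∈ Icc (0 : ℝ) 1,
      h t = p → t ∈ Ioo (0 : ℝ) 1 := by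
    intro h a b h0 h1 t ht htp
    refine ⟨ht.1.lt_of_ne' ?_, ht.2.lt_of_ne ?_⟩
    · rintro rfl; exact hpV ⟨a, h0.symm.trans htp⟩
    · rintro rfl; exact hpV ⟨b, h1.symm.trans htp⟩
  obtain ⟨s₀, hs₀, hs₀p⟩ := hfA.symm ▸ hpA
  obtain ⟨t₀, ht₀, ht₀p⟩ := hgB.symm ▸ hpB
  have huniq : ∀ s ∈ Icc (0 : ℝ) 1, ∀ t ∈ Icc (0 : ℝ) 1, f s = g t → s = s₀ ∧ t = t₀ := by
    intro s hs t ht hst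
    have hc := D.crosses_of_mem heA heB hdis (p := f s) (hfA ▸ mem_image_of_mem f hs)
      (hgB ▸ hst ▸ mem_image_of_mem g ht)
    have hsp := (hD.1 _ _ _ _ _ hc hp).2
    exact ⟨hfi hs hs₀ (hsp.trans hs₀p.symm),
      hgi ht ht₀ (hst.symm.trans (hsp.trans ht₀p.symm))⟩
  have ht₀' := hIoo g _ _ hg0 hg1 t₀ ht₀ ht₀p
  suffices hcross : ∀ t ∈ Ioo t₀ 1,
      g t ∉ connectedComponentIn (R ∪ f '' Icc 0 1)ᶜ (g (t₀ / 2)) by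
    obtain ⟨x, hx, hxu, hxv⟩ := exists_common_face_of_crossing hR hf hg hfi hgi hfR hgR
      (hf0 ▸ hposR u) (hg0 ▸ hposR v) (hg1 ▸ hposR F.w₁) (hIoo f _ _ hf0 hf1 s₀ hs₀ hs₀p) ht₀'
      (hs₀p.trans ht₀p.symm) huniq hcross
    rw [himage] at hx hxu hxv
    exact ⟨x, hx, hf0 ▸ hxu, hg0 ▸ hxv⟩
  intro t ht htC
  obtain ⟨ht₀0, -⟩ := ht₀'
  obtain ⟨htt, ht1⟩ := ht
  have hXc : IsClosed (R ∪ f '' Icc 0 1) :=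
    (hR.union (isCompact_Icc.image_of_continuousOn hf)).isClosed
  have hmem : g (t₀ / 2) ∈ (R ∪ f '' Icc 0 1)ᶜ := connectedComponentIn_nonempty_iff.1 ⟨_, htC⟩
  have hCpath : IsPathConnected (connectedComponentIn (R ∪ f '' Icc 0 1)ᶜ (g (t₀ / 2))) :=
    hXc.isOpen_compl.connectedComponentIn.isConnected_iff_isPathConnected.1
      (isConnected_connectedComponentIn_iff.2 hmem)
  have hgpath : ∀ a b, 0 ≤ a → a ≤ b → b ≤ 1 → JoinedIn (g '' Icc a b) (g a) (g b) :=
    fun a b ha hab hb => (((convex_Icc a b).isPathConnected (nonempty_Icc.2 hab)).image'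
      (hg.mono (Icc_subset_Icc ha hb))).joinedIn _ (mem_image_of_mem g ⟨le_rfl, hab⟩) _
        (mem_image_of_mem g ⟨hab, le_rfl⟩)
  refine F.not_disjoint_reroute hD (B := g '' Icc 0 (t₀ / 2) ∪
    connectedComponentIn (R ∪ f '' Icc 0 1)ᶜ (g (t₀ / 2)) ∪ g '' Icc t 1) ?_ ?_ ?_
  · rw [← hg0, ← hg1]
    refine (((hgpath 0 (t₀ / 2) le_rfl (by linarith) (by linarith)).mono ?_).trans
      ((hCpath.joinedIn _ (mem_connectedComponentIn hmem) _ htC).mono ?_)).trans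
      ((hgpath t 1 (by linarith) ht1.le le_rfl).mono subset_union_right)
    · exact subset_union_left.trans subset_union_left
    · exact subset_union_right.trans subset_union_left
  · rintro q ((⟨r, hr, rfl⟩ | hq) | ⟨r, hr, rfl⟩) e he hqe
    · exact hgB ▸ mem_image_of_mem g ⟨hr.1, by linarith [hr.2]⟩
    · have hq' := connectedComponentIn_subset _ _ hq
      by_contra hne
      refine hq' ?_
      by_cases h1 : e = s(u, F.w₂)
      · exact Or.inr (hfA ▸ h1 ▸ hqe)
      · exact Or.inl (hmemR e he h1 (fun h => hne (h ▸ hqe)) hqe)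
    · exact hgB ▸ mem_image_of_mem g ⟨by linarith [hr.1], hr.2⟩
  · rw [← hfA]
    refine disjoint_left.2 ?_
    rintro _ ⟨s, hs, rfl⟩ ((⟨r, hr, hrs⟩ | hq) | ⟨r, hr, hrs⟩)
    · have := (huniq s hs r ⟨hr.1, by linarith [hr.2]⟩ hrs.symm).2
      linarith [hr.2]
    · exact connectedComponentIn_subset _ _ hq (Or.inr (mem_image_of_mem f hs))
    · have := (huniq s hs r ⟨by linarith [hr.1], hr.2⟩ hrs.symm).2
      linarith [hr.1]

end Fence

end

/-- **Fences force a crossing.** Let `G` be a graph containing a fence `F(u,v)` between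
`u` and `v` as a subgraph.  Then in every 1-planar drawing of `G` the two single edges
`u w₂` and `v w₁` of the fence cross each other (and consequently `u` and `v` lie on a
common face of the drawing). -/
theorem fence_single_edges_cross [Fintype V] (G : SimpleGraph V) (u v : V)
    (F : Fence G u v) (D : Drawing G) (hD : D.IsOnePlanar) :
    (∃ p, D.Crosses s(u, F.w₂) s(v, F.w₁) p) ∧ D.Cofacial u v := by
  exact ⟨F.exists_crosses hD, F.cofacial hD⟩

end OnePlanarity
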